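/- Let p ≥ 4 and n be integers with 2 ≤ n ≤ p − 2, and set c = 2p+1. Consider a 2-coloring of the edges of the complete graph on a vertex set V with |V| = n + 3p + 3, and let C be a blue cycle on 2p+2 vertices with primed vertex u_C and associated set S_C. Let T = {q ∈ V(C) : q has at least p+1 red neighbors in Z_C}. If |S_C| ≥ p + 1, |T| ≥ p + 2, and some vertex q ∈ V(C) has at least n + 1 blue neighbors in Z_C, then the coloring contains a monochromatic copy of S_c(n,2). -/

import Mathlib

open SimpleGraph

/-- The relation generating the edges of the linked double star `S_c(n,m)`:
vertices are `a_1, …, a_c` (the link, modelled by `Fin c`), the spokes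
`v_1, …, v_n` of the `n`-star at `a_1` (modelled by `Fin n`), and the spokes
`w_1, …, w_m` of the `m`-star at `a_c` (modelled by `Fin m`). -/
def ldsRel (c n m : ℕ) : (Fin c ⊕ Fin n ⊕ Fin m) → (Fin c ⊕ Fin n ⊕ Fin m) → Prop
  | Sum.inl i, Sum.inl j => (j : ℕ) = (i : ℕ) + 1
  | Sum.inl i, Sum.inr (Sum.inl _) => (i : ℕ) = 0
  | Sum.inl i, Sum.inr (Sum.inr _) => (i : ℕ) = c - 1
  | _, _ => False

/-- The linked double star `S_c(n,m)`. -/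
def LinkedDoubleStar (c n m : ℕ) : SimpleGraph (Fin c ⊕ Fin n ⊕ Fin m) :=
  SimpleGraph.fromRel (ldsRel c n m)

/-- `G` contains a (not necessarily induced) subgraph isomorphic to `H`. -/
def HasCopy {α β : Type*} (H : SimpleGraph α) (G : SimpleGraph β) : Prop :=
  ∃ f : α → β, Function.Injective f ∧ ∀ ⦃a b⦄, H.Adj a b → G.Adj (f a) (f b)

/-- A 2-coloring of the complete graph on `β` is encoded by the graph `G` of red
edges (so `Gᶜ` is the graph of blue edges).  `HasMonoLDS G c n m` says this
coloring contains a monochromatic copy of `S_c(n,m)`. -/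
def HasMonoLDS {β : Type*} (G : SimpleGraph β) (c n m : ℕ) : Prop :=
  HasCopy (LinkedDoubleStar c n m) G ∨ HasCopy (LinkedDoubleStar c n m) Gᶜ

/-- Every 2-coloring of the edges of `K_r` contains a monochromatic `S_c(n,m)`. -/
def IsRamseyLDS (c n m r : ℕ) : Prop :=
  ∀ G : SimpleGraph (Fin r), HasMonoLDS G c n m

/-- The Ramsey number of the linked double star `S_c(n,m)`: the least positive
`r` such that every 2-coloring of the edges of `K_r` contains a monochromatic
copy of `S_c(n,m)`. -/
noncomputable def ramseyLDS (c n m : ℕ) : ℕ :=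
  sInf {r | 0 < r ∧ IsRamseyLDS c n m r}

/-- `f` exhibits a cycle on `L` vertices in `G` (the vertices `f 0, f 1, …`
arranged cyclically, consecutive ones adjacent in `G`). -/
def IsCycleMap {β : Type*} {L : ℕ} (G : SimpleGraph β) (f : ZMod L → β) : Prop :=
  Function.Injective f ∧ ∀ i : ZMod L, G.Adj (f i) (f (i + 1))

/-- For a monochromatic cycle with vertex set `C`, all of whose edges have the
color given by the graph `H`, `cycStat H C` is the maximum over vertices
`z ∉ C` of the number of `H`-edges from `z` into `C` (denoted `s(C)`). -/
noncomputable def cycStat {β : Type*} (H : SimpleGraph β) (C : Set β) : ℕ :=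
  sSup ((fun z => ({w ∈ C | H.Adj z w}).ncard) '' Cᶜ)


/-- alternating path covering `j` vertices of `A` -/
def AltPath {α β : Type*} (A : Finset α) (Z : Finset β) (r : α → β → Prop) (j : ℕ) : Prop :=
  ∃ (t : ℕ → α) (z : ℕ → β), (∀ i < j, t i ∈ A) ∧ (∀ i ≤ j, z i ∈ Z) ∧
    (∀ i < j, ∀ k < j, t i = t k → i = k) ∧ (∀ i ≤ j, ∀ k ≤ j, z i = z k → i = k) ∧
    (∀ i < j, r (t i) (z i)) ∧ (∀ i < j, r (t i) (z (i + 1)))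

section
variable {α β : Type*} {A : Finset α} {Z : Finset β} {r : α → β → Prop} {j : ℕ}
  {t : ℕ → α} {z : ℕ → β}

lemma alt_front (htA : ∀ i < j, t i ∈ A) (hzZ : ∀ i ≤ j, z i ∈ Z)
    (hti : ∀ i < j, ∀ k < j, t i = t k → i = k) (hzi : ∀ i ≤ j, ∀ k ≤ j, z i = z k → i = k)
    (h1 : ∀ i < j, r (t i) (z i)) (h2 : ∀ i < j, r (t i) (z (i + 1)))
    {a : α} (ha : a ∈ A) (hat : ∀ i < j, t i ≠ a) {x y : β} (hx : x ∈ Z) (hy : y ∈ Z)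
    (hxy : x ≠ y) (hxz : ∀ i ≤ j, z i ≠ x) (hyz : ∀ i ≤ j, z i ≠ y)
    (hax : r a x) (hay : r a y) (h0 : 0 < j → r (t 0) y) : AltPath A Z r (j + 1) := by
  refine ⟨fun k => if k = 0 then a else t (k - 1),
    fun k => if k = 0 then x else if k = 1 then y else z (k - 1), ?_, ?_, ?_, ?_, ?_, ?_⟩
  · grind
  · grind
  · grind
  · grind
  · intro i hi
    rcases i with _ | _ | i <;> grind
  · intro i hi
    rcases i with _ | _ | i <;> grind

lemma alt_ins (htA : ∀ i < j, t i ∈ A) (hzZ : ∀ i ≤ j, z i ∈ Z)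
    (hti : ∀ i < j, ∀ k < j, t i = t k → i = k) (hzi : ∀ i ≤ j, ∀ k ≤ j, z i = z k → i = k)
    (h1 : ∀ i < j, r (t i) (z i)) (h2 : ∀ i < j, r (t i) (z (i + 1)))
    {a : α} (ha : a ∈ A) (hat : ∀ i < j, t i ≠ a) {x : β} (hx : x ∈ Z)
    (hxz : ∀ i ≤ j, z i ≠ x) (hax : r a x) {i : ℕ} (hi : i ≤ j) (hai : r a (z i))
    (h0 : i < j → r (t i) x) : AltPath A Z r (j + 1) := by
  refine ⟨fun k => if k < i then t k else if k = i then a else t (k - 1),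
    fun k => if k ≤ i then z k else if k = i + 1 then x else z (k - 1), ?_, ?_, ?_, ?_, ?_, ?_⟩
  · grind
  · grind
  · grind
  · grind
  · grind
  · intro k hk
    rcases lt_trichotomy k i with h | h | h
    · grind
    · grind
    · obtain ⟨d, rfl⟩ : ∃ d, k = d + 1 := ⟨k - 1, by omega⟩
      grind

lemma alt_rev (htA : ∀ i < j, t i ∈ A) (hzZ : ∀ i ≤ j, z i ∈ Z)
    (hti : ∀ i < j, ∀ k < j, t i = t k → i = k) (hzi : ∀ i ≤ j, ∀ k ≤ j, z i = z k → i = k)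
    (h1 : ∀ i < j, r (t i) (z i)) (h2 : ∀ i < j, r (t i) (z (i + 1)))
    {a : α} (ha : a ∈ A) (hat : ∀ i < j, t i ≠ a) {x : β} (hx : x ∈ Z)
    (hxz : ∀ i ≤ j, z i ≠ x) {i l : ℕ} (hil : i < l) (hl : l < j) (hai : r a (z i))
    (hal : r a (z l)) (hix : r (t i) x) (hlx : r (t l) x) : AltPath A Z r (j + 1) := by
  refine ⟨fun k => if k < i then t k else if k = i then a else
      if k ≤ l then t (l + i - k) else t (k - 1),
    fun k => if k ≤ i then z k else if k ≤ l then z (l + i + 1 - k) else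
      if k = l + 1 then x else z (k - 1), ?_, ?_, ?_, ?_, ?_, ?_⟩
  · grind
  · grind
  · grind
  · grind
  · intro k hk
    dsimp only
    split_ifs <;> try omega
    · grind
    · grind
    · have := h2 (l + i - k) (by omega)
      rwa [show l + i - k + 1 = l + i + 1 - k by omega] at this
    · grind
    · grind
  · intro k hk
    dsimp only
    split_ifs <;> try omega
    · grind
    · have := h1 (l + i - k) (by omega)
      grind
    · grind
    · grind
    · have := h2 (k-1) (by omega)
      grind
end

lemma alt_exists {α β : Type*} (A : Finset α) (Z : Finset β) (r : α → β → Prop) (m : ℕ)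
    (hm : 1 ≤ m) (hA : m ≤ A.card) (hZ : Z.card ≤ 2 * m + 1)
    (hd : ∀ a ∈ A, ∃ S ⊆ Z, m + 2 ≤ S.card ∧ ∀ b ∈ S, r a b) :
    ∀ j ≤ m, AltPath A Z r j := by
  classical
  intro j
  induction j with
  | zero =>
    intro _
    obtain ⟨a, ha⟩ : A.Nonempty := Finset.card_pos.1 (by omega)
    obtain ⟨S, hSZ, hS, -⟩ := hd a ha
    obtain ⟨b, hb⟩ : S.Nonempty := Finset.card_pos.1 (by omega)
    exact ⟨fun _ => a, fun _ => b, by simp, fun _ _ => hSZ hb, by simp, by simp, by simp, by simp⟩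
  | succ j ih =>
    intro hj
    obtain ⟨t, z, htA, hzZ, hti, hzi, h1, h2⟩ := ih (by omega)
    by_contra hcon
    choose! S hSZ hS hSr using hd
    have hTc : ((Finset.range j).image t).card ≤ j :=
      Finset.card_image_le.trans (by simp)
    obtain ⟨a, ha, hat⟩ : ∃ a ∈ A, a ∉ (Finset.range j).image t :=
      Finset.exists_mem_notMem_of_card_lt_card (by omega)
    have hat' : ∀ i < j, t i ≠ a := by
      intro i hi h; exact hat (Finset.mem_image.2 ⟨i, by simpa using hi, h⟩)
    set P := (Finset.range (j + 1)).image z with hP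
    have hPc : P.card = j + 1 := by
      rw [hP, Finset.card_image_of_injOn, Finset.card_range]
      intro i hi k hk h
      simp at hi hk
      exact hzi i (by omega) k (by omega) h
    have hPZ : P ⊆ Z := by
      intro b hb
      obtain ⟨i, hi, rfl⟩ := Finset.mem_image.1 hb
      simp at hi
      exact hzZ i (by omega)
    have hnP : ∀ b ∉ P, ∀ i ≤ j, z i ≠ b := by
      intro b hb i hi h
      exact hb (Finset.mem_image.2 ⟨i, by simp; omega, h⟩)
    have hRc : (Z \ P).card = Z.card - (j + 1) := by
      rw [Finset.card_sdiff_of_subset hPZ, hPc]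
    have hPZc := Finset.card_le_card hPZ
    have hN : ∀ b ∈ A, m + 2 ≤ (S b \ P).card + (j + 1) := by
      intro b hb
      have h3 := Finset.le_card_sdiff P (S b)
      have := hS b hb
      omega
    set W := (Finset.range (j + 1)).filter (fun i => z i ∈ S a) with hW
    have hWm : ∀ i ∈ W, i < j ∧ z i ∈ S a := by
      intro i hi
      simp [hW] at hi
      refine ⟨?_, hi.2⟩
      by_contra hij
      have : i = j := by omega
      subst this
      obtain ⟨x, hx⟩ : (S a \ P).Nonempty := Finset.card_pos.1 (by have := hN a ha; omega)
      simp only [Finset.mem_sdiff] at hx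
      exact hcon (alt_ins htA hzZ hti hzi h1 h2 ha hat' (hSZ a ha hx.1) (hnP x hx.2)
        (hSr a ha x hx.1) le_rfl (hSr a ha _ hi.2) (by omega))
    have hWc : m + 2 ≤ (S a \ P).card + W.card := by
      have h3 : (S a ∩ P).card ≤ W.card := by
        have : S a ∩ P ⊆ W.image z := by
          intro b hb
          simp only [Finset.mem_inter, hP, Finset.mem_image] at hb
          obtain ⟨hb, i, hi, rfl⟩ := hb
          exact Finset.mem_image_of_mem _ (Finset.mem_filter.2 ⟨hi, hb⟩)
        exact (Finset.card_le_card this).trans Finset.card_image_le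
      have := Finset.card_sdiff_add_card_inter (S a) P
      have := hS a ha
      omega
    have hdis1 : ∀ i ∈ W, Disjoint (S a \ P) (S (t i) \ P) := by
      intro i hi
      obtain ⟨hij, hia⟩ := hWm i hi
      rw [Finset.disjoint_left]
      intro x hx hx'
      simp only [Finset.mem_sdiff] at hx hx'
      exact hcon (alt_ins htA hzZ hti hzi h1 h2 ha hat' (hSZ a ha hx.1) (hnP x hx.2)
        (hSr a ha x hx.1) hij.le (hSr a ha _ hia) (fun _ => hSr _ (htA i hij) _ hx'.1))
    have hdis2' : ∀ i ∈ W, ∀ l ∈ W, i < l → Disjoint (S (t i) \ P) (S (t l) \ P) := by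
      intro i hi l hl hil
      obtain ⟨hij, hia⟩ := hWm i hi
      obtain ⟨hlj, hla⟩ := hWm l hl
      rw [Finset.disjoint_left]
      intro x hx hx'
      simp only [Finset.mem_sdiff] at hx hx'
      exact hcon (alt_rev htA hzZ hti hzi h1 h2 ha hat' (hSZ _ (htA i hij) hx.1) (hnP x hx.2)
        hil hlj (hSr a ha _ hia) (hSr a ha _ hla) (hSr _ (htA i hij) _ hx.1)
        (hSr _ (htA l hlj) _ hx'.1))
    have hdis2 : ∀ i ∈ W, ∀ l ∈ W, i ≠ l → Disjoint (S (t i) \ P) (S (t l) \ P) := by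
      intro i hi l hl hil
      rcases lt_or_gt_of_ne hil with h | h
      · exact hdis2' i hi l hl h
      · exact (hdis2' l hl i hi h).symm
    have hsum : (S a \ P).card + ∑ i ∈ W, (S (t i) \ P).card ≤ (Z \ P).card := by
      rw [← Finset.card_biUnion hdis2, ← Finset.card_union_of_disjoint]
      · apply Finset.card_le_card
        intro x hx
        simp only [Finset.mem_union, Finset.mem_biUnion, Finset.mem_sdiff] at hx ⊢
        rcases hx with hx | ⟨i, hi, hx⟩
        · exact ⟨hSZ a ha hx.1, hx.2⟩
        · exact ⟨hSZ _ (htA i (hWm i hi).1) hx.1, hx.2⟩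
      · rw [Finset.disjoint_biUnion_right]
        exact hdis1
    have hsum2 : W.card * (m + 1 - j) ≤ ∑ i ∈ W, (S (t i) \ P).card := by
      rw [← smul_eq_mul]
      apply Finset.card_nsmul_le_sum
      intro i hi
      have := hN _ (htA i (hWm i hi).1)
      omega
    have hw0 : W.card = 0 := by
      by_contra hw
      obtain ⟨w, hw⟩ : ∃ w, W.card = w + 1 := ⟨W.card - 1, by omega⟩
      obtain ⟨d, rfl⟩ : ∃ d, m = j + 1 + d := ⟨m - (j + 1), by omega⟩
      rw [hw, show j + 1 + d + 1 - j = d + 2 by omega] at hsum2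
      have : (w + 1) * (d + 2) = w * d + 2 * w + d + 2 := by ring
      have : 0 ≤ w * d := Nat.zero_le _
      omega
    obtain ⟨y, hy, hy0⟩ : ∃ y ∈ S a \ P, 0 < j → r (t 0) y := by
      by_cases hj0 : 0 < j
      · by_contra hno
        push Not at hno
        have hdj : Disjoint (S a \ P) (S (t 0) \ P) := by
          rw [Finset.disjoint_left]
          intro x hx hx'
          simp only [Finset.mem_sdiff] at hx'
          exact (hno x hx).2 (hSr _ (htA 0 hj0) _ hx'.1)
        have h4 : (S a \ P ∪ S (t 0) \ P).card ≤ (Z \ P).card := by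
          apply Finset.card_le_card
          apply Finset.union_subset
          · exact Finset.sdiff_subset_sdiff (hSZ a ha) le_rfl
          · exact Finset.sdiff_subset_sdiff (hSZ _ (htA 0 hj0)) le_rfl
        rw [Finset.card_union_of_disjoint hdj] at h4
        have := hN _ (htA 0 hj0)
        omega
      · obtain ⟨y, hy⟩ : (S a \ P).Nonempty := Finset.card_pos.1 (by omega)
        exact ⟨y, hy, fun h => absurd h hj0⟩
    obtain ⟨x, hx⟩ : ((S a \ P).erase y).Nonempty :=
      Finset.card_pos.1 (by rw [Finset.card_erase_of_mem hy]; omega)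
    simp only [Finset.mem_sdiff, Finset.mem_erase] at hx hy
    exact hcon (alt_front htA hzZ hti hzi h1 h2 ha hat' (hSZ a ha hx.2.1) (hSZ a ha hy.1) hx.1
      (hnP x hx.2.2) (hnP y hy.2) (hSr a ha _ hx.2.1) (hSr a ha _ hy.1) hy0)

lemma copy_of {V : Type*} [DecidableEq V] (H : SimpleGraph V) (c n : ℕ) (hc : 1 ≤ c) (f : ℕ → V)
    (hinj : ∀ i < c, ∀ k < c, f i = f k → i = k)
    (hadj : ∀ i, i + 1 < c → H.Adj (f i) (f (i + 1)))
    (A B : Finset V) (hA : n ≤ A.card) (hB : 2 ≤ B.card) (hAB : Disjoint A B)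
    (hAf : ∀ a ∈ A, H.Adj (f 0) a ∧ ∀ i < c, f i ≠ a)
    (hBf : ∀ a ∈ B, H.Adj (f (c - 1)) a ∧ ∀ i < c, f i ≠ a) :
    HasCopy (LinkedDoubleStar c n 2) H := by
  obtain ⟨gA, hgA⟩ : ∃ g : Fin n → V, Function.Injective g ∧ ∀ i, g i ∈ A := by
    let e := A.equivFin
    refine ⟨fun i => (e.symm (Fin.castLE hA i)).1, ?_, fun i => (e.symm _).2⟩
    intro i k h
    have := e.symm.injective (Subtype.ext h)
    exact Fin.castLE_injective hA this
  obtain ⟨gB, hgB⟩ : ∃ g : Fin 2 → V, Function.Injective g ∧ ∀ i, g i ∈ B := by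
    let e := B.equivFin
    refine ⟨fun i => (e.symm (Fin.castLE hB i)).1, ?_, fun i => (e.symm _).2⟩
    intro i k h
    have := e.symm.injective (Subtype.ext h)
    exact Fin.castLE_injective hB this
  let F : (Fin c ⊕ Fin n ⊕ Fin 2) → V := Sum.elim (fun i => f i) (Sum.elim gA gB)
  have key : ∀ a b, ldsRel c n 2 a b → H.Adj (F a) (F b) := by
    rintro (i | i | i) (k | k | k) h <;> simp only [ldsRel] at h
    · have := hadj i (by omega)
      rw [← h] at this
      exact this
    · have := (hAf _ (hgA.2 k)).1
      simpa [F, h] using this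
    · have := (hBf _ (hgB.2 k)).1
      simpa [F, h] using this
  refine ⟨F, ?_, ?_⟩
  · rw [Finset.disjoint_left] at hAB
    rintro (i | i | i) (k | k | k) h <;> simp only [F, Sum.elim_inl, Sum.elim_inr] at h
    · rw [Fin.ext (hinj i i.2 k k.2 h)]
    · exact absurd h ((hAf _ (hgA.2 k)).2 i i.2)
    · exact absurd h ((hBf _ (hgB.2 k)).2 i i.2)
    · exact absurd h.symm ((hAf _ (hgA.2 i)).2 k k.2)
    · rw [hgA.1 h]
    · exact absurd (h ▸ hgA.2 i) (fun h' => hAB h' (hgB.2 k))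
    · exact absurd h.symm ((hBf _ (hgB.2 i)).2 k k.2)
    · exact absurd (h ▸ hgB.2 i) (fun h' => hAB (hgA.2 k) h')
    · rw [hgB.1 h]
  · intro a b hab
    rw [LinkedDoubleStar, SimpleGraph.fromRel_adj] at hab
    rcases hab.2 with h | h
    · exact key a b h
    · exact (key b a h).symm

/-- red case -/
lemma red_case {V : Type*} [DecidableEq V] (p n : ℕ) (hp : 4 ≤ p) (hnp : n ≤ p - 2)
    (G : SimpleGraph V) (Z T : Finset V) (hZ : Z.card = n + p + 1) (hT : p + 2 ≤ T.card)
    (hTZ : Disjoint T Z)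
    (hTd : ∀ a ∈ T, ∃ S ⊆ Z, p + 1 ≤ S.card ∧ ∀ b ∈ S, G.Adj a b)
    (f1 f2 x : V) (h1Z : f1 ∉ Z) (h2Z : f2 ∉ Z) (hxZ : x ∉ Z) (h12 : f1 ≠ f2) (hx1 : x ≠ f1)
    (hx2 : x ≠ f2) (h1 : ∀ b ∈ Z, G.Adj f1 b) (h2 : ∀ b ∈ Z, G.Adj f2 b) (h1x : G.Adj f1 x) :
    HasCopy (LinkedDoubleStar (2 * p + 1) n 2) G := by
  have hA : p - 1 ≤ (T \ {f1, f2, x}).card := by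
    have h3 := Finset.le_card_sdiff {f1, f2, x} T
    have : ({f1, f2, x} : Finset V).card ≤ 3 := Finset.card_le_three
    omega
  obtain ⟨t, z, htA, hzZ, hti, hzi, hr1, hr2⟩ := alt_exists (T \ {f1, f2, x}) Z (fun a b => G.Adj a b)
    (p - 1) (by omega) hA (by omega) (by
      intro a ha
      obtain ⟨S, hS, hc, h⟩ := hTd a (Finset.mem_sdiff.1 ha).1
      exact ⟨S, hS, by omega, h⟩) (p - 1) le_rfl
  have htA' : ∀ i < p - 1, t i ≠ f1 ∧ t i ≠ f2 ∧ t i ≠ x ∧ t i ∉ Z := by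
    intro i hi
    have h := htA i hi
    simp at h
    exact ⟨h.2.1, h.2.2.1, h.2.2.2, Finset.disjoint_left.1 hTZ h.1⟩
  set P := (Finset.range p).image z with hP
  have hPc : P.card ≤ p := Finset.card_image_le.trans (by simp)
  have hR : n + 1 ≤ (Z \ P).card := by
    have := Finset.le_card_sdiff P Z
    omega
  have hRm : ∀ b ∈ Z \ P, b ∈ Z ∧ ∀ i ≤ p - 1, z i ≠ b := by
    intro b hb
    simp only [Finset.mem_sdiff] at hb
    refine ⟨hb.1, fun i hi h => hb.2 (Finset.mem_image.2 ⟨i, by simp; omega, h⟩)⟩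
  obtain ⟨y, hy⟩ : (Z \ P).Nonempty := Finset.card_pos.1 (by omega)
  have hyZ := hRm y hy
  let f : ℕ → V := fun k => if k = 0 then f2 else if k = 2 * p then f1 else
    if k % 2 = 1 then z (k / 2) else t (k / 2 - 1)
  have hf0 : f 0 = f2 := by simp [f]
  have hfl : f (2 * p) = f1 := by simp [f]; omega
  have hfo : ∀ i, f (2 * i + 1) = z i := by
    intro i; simp only [f]; rw [if_neg (by omega), if_neg (by omega), if_pos (by omega)]
    congr 1; omega
  have hfe : ∀ i < p - 1, f (2 * i + 2) = t i := by
    intro i hi; simp only [f]; rw [if_neg (by omega), if_neg (by omega), if_neg (by omega)]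
    congr 1; omega
  have hcases : ∀ k < 2 * p + 1, k = 0 ∨ k = 2 * p ∨ (∃ i ≤ p - 1, k = 2 * i + 1) ∨
      ∃ i < p - 1, k = 2 * i + 2 := by
    intro k hk
    by_cases k = 0
    · tauto
    by_cases k = 2 * p
    · tauto
    rcases Nat.even_or_odd' k with ⟨i, hi | hi⟩
    · exact Or.inr (Or.inr (Or.inr ⟨i - 1, by omega, by omega⟩))
    · exact Or.inr (Or.inr (Or.inl ⟨i, by omega, by omega⟩))
  apply copy_of G (2 * p + 1) n (by omega) f ?_ ?_ ((Z \ P).erase y) {y, x}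
  · rw [Finset.card_erase_of_mem hy]; omega
  · rw [Finset.card_pair]; rintro rfl; exact hxZ hyZ.1
  · rw [Finset.disjoint_left]
    intro b hb hb'
    simp only [Finset.mem_erase, Finset.mem_sdiff, Finset.mem_insert, Finset.mem_singleton] at hb hb'
    rcases hb' with h | h
    · exact hb.1 h
    · subst h; exact hxZ hb.2.1
  · intro b hb
    have hb' := hRm b (Finset.mem_of_mem_erase hb)
    refine ⟨by rw [hf0]; exact h2 b hb'.1, ?_⟩
    intro k hk
    rcases hcases k hk with rfl | rfl | ⟨i, hi, rfl⟩ | ⟨i, hi, rfl⟩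
    · rw [hf0]; rintro rfl; exact h2Z hb'.1
    · rw [hfl]; rintro rfl; exact h1Z hb'.1
    · rw [hfo]; exact hb'.2 i hi
    · rw [hfe i hi]; rintro rfl; exact (htA' i hi).2.2.2 hb'.1
  · intro b hb
    simp only [Finset.mem_insert, Finset.mem_singleton] at hb
    rw [show 2 * p + 1 - 1 = 2 * p by omega, hfl]
    rcases hb with rfl | rfl
    · refine ⟨h1 _ hyZ.1, ?_⟩
      intro k hk
      rcases hcases k hk with rfl | rfl | ⟨i, hi, rfl⟩ | ⟨i, hi, rfl⟩
      · rw [hf0]; rintro rfl; exact h2Z hyZ.1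
      · rw [hfl]; rintro rfl; exact h1Z hyZ.1
      · rw [hfo]; exact hyZ.2 i hi
      · rw [hfe i hi]; rintro rfl; exact (htA' i hi).2.2.2 hyZ.1
    · refine ⟨h1x, ?_⟩
      intro k hk
      rcases hcases k hk with rfl | rfl | ⟨i, hi, rfl⟩ | ⟨i, hi, rfl⟩
      · rw [hf0]; exact hx2.symm
      · rw [hfl]; exact hx1.symm
      · rw [hfo]; rintro rfl; exact hxZ (hzZ i hi)
      · rw [hfe i hi]; exact (htA' i hi).2.2.1
  · intro k hk l hl h
    rcases hcases k hk with rfl | rfl | ⟨i, hi, rfl⟩ | ⟨i, hi, rfl⟩ <;>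
    rcases hcases l hl with rfl | rfl | ⟨i', hi', rfl⟩ | ⟨i', hi', rfl⟩ <;> grind
  · intro k hk
    rcases hcases k (by omega) with rfl | rfl | ⟨i, hi, rfl⟩ | ⟨i, hi, rfl⟩
    · rw [hf0, hfo 0]; exact h2 _ (hzZ 0 (by omega))
    · omega
    · rw [hfo]
      by_cases hi' : i < p - 1
      · rw [hfe i hi']; exact (hr1 i hi').symm
      · rw [show 2 * i + 1 + 1 = 2 * p by omega, hfl]; exact (h1 _ (hzZ i hi)).symm
    · rw [hfe i hi, show 2 * i + 2 + 1 = 2 * (i + 1) + 1 by ring, hfo]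
      exact hr2 i hi

/-- blue case: a long path from `Q (2p+2)` to `Q 2` avoiding two blue neighbours of `Q 2`. -/
lemma blue_end {V : Type*} [DecidableEq V] (p n : ℕ) (H : SimpleGraph V)
    (Q : ℕ → V) (u : V) (hQu : ∀ i, Q i ≠ u)
    (hinj : ∀ i k, 1 ≤ i → i ≤ 2 * p + 2 → 1 ≤ k → k ≤ 2 * p + 2 → Q i = Q k → i = k)
    (A : Finset V) (hA : n + 1 ≤ A.card) (hAQ : ∀ a ∈ A, ∀ i, Q i ≠ a)
    (hAd : ∀ a ∈ A, H.Adj (Q (2 * p + 2)) a)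
    (g : ℕ → ℕ) (f : ℕ → V) (hf0 : f 0 = Q (2 * p + 2)) (hfl : f (2 * p) = Q 2)
    (l : ℕ) (hf : ∀ k, f k = if k = l then u else Q (g k))
    (hadj : ∀ i, i < 2 * p → H.Adj (f i) (f (i + 1)))
    (hg : ∀ k ≤ 2 * p, k ≠ l → 2 ≤ g k ∧ g k ≤ 2 * p + 2)
    (hgi : ∀ k ≤ 2 * p, ∀ k' ≤ 2 * p, k ≠ l → k' ≠ l → g k = g k' → k = k')
    (b : ℕ) (hb : 2 ≤ b) (hb2 : b ≤ 2 * p + 2) (hbg : ∀ k ≤ 2 * p, k ≠ l → g k ≠ b)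
    (h21 : H.Adj (Q 2) (Q 1)) (h2b : H.Adj (Q 2) (Q b)) :
    HasCopy (LinkedDoubleStar (2 * p + 1) n 2) H := by
  apply copy_of H (2 * p + 1) n (by omega) f ?_ ?_ (A.erase u) {Q 1, Q b}
  · have := Finset.pred_card_le_card_erase (s := A) (a := u)
    omega
  · rw [Finset.card_pair]
    intro h
    have := hinj 1 b le_rfl (by omega) (by omega) hb2 h
    omega
  · rw [Finset.disjoint_left]
    intro a ha ha'
    simp only [Finset.mem_insert, Finset.mem_singleton] at ha'
    rcases ha' with h | h
    · exact hAQ a (Finset.mem_of_mem_erase ha) _ h.symm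
    · exact hAQ a (Finset.mem_of_mem_erase ha) _ h.symm
  · intro a ha
    have ha' := Finset.mem_erase.1 ha
    refine ⟨by rw [hf0]; exact hAd a ha'.2, fun i hi => ?_⟩
    rw [hf]
    split_ifs
    · exact ha'.1.symm
    · exact hAQ a ha'.2 _
  · intro a ha
    rw [show 2 * p + 1 - 1 = 2 * p by omega, hfl]
    simp only [Finset.mem_insert, Finset.mem_singleton] at ha
    rcases ha with rfl | rfl
    · refine ⟨h21, fun i hi => ?_⟩
      rw [hf]
      split_ifs with h
      · exact (hQu _).symm
      · intro h'
        have h3 := hg i (by omega) h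
        have := hinj _ _ (by omega) (by omega) (by omega) (by omega) h'
        omega
    · refine ⟨h2b, fun i hi => ?_⟩
      rw [hf]
      split_ifs with h
      · exact (hQu _).symm
      · intro h'
        have h3 := hg i (by omega) h
        exact hbg i (by omega) h (hinj _ _ (by omega) (by omega) (by omega) (by omega) h')
  · intro i hi k hk h
    rw [hf, hf] at h
    split_ifs at h with h3 h4 h4
    · omega
    · exact absurd h.symm (hQu _)
    · exact absurd h (hQu _)
    · have h5 := hg i (by omega) h3
      have h6 := hg k (by omega) h4
      exact hgi i (by omega) k (by omega) h3 h4
        (hinj _ _ (by omega) (by omega) (by omega) (by omega) h)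
  · intro i hi
    exact hadj i (by omega)

/-- simple blue case: the end of the long cyclic path has an outside neighbour. -/
lemma blue_simple {V : Type*} [DecidableEq V] (p n : ℕ) (H : SimpleGraph V)
    (f : ℕ → V)
    (hinj : ∀ i k, i ≤ 2 * p + 1 → k ≤ 2 * p + 1 → f i = f k → i = k)
    (hadj : ∀ i, H.Adj (f i) (f (i + 1)))
    (A : Finset V) (hA : n + 1 ≤ A.card) (hAQ : ∀ a ∈ A, ∀ i, f i ≠ a)
    (hAd : ∀ a ∈ A, H.Adj (f 0) a) (y : V) (hy : ∀ i, f i ≠ y) (hyd : H.Adj (f (2 * p)) y) :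
    HasCopy (LinkedDoubleStar (2 * p + 1) n 2) H := by
  apply copy_of H (2 * p + 1) n (by omega) f ?_ ?_ (A.erase y) {y, f (2 * p + 1)}
  · have := Finset.pred_card_le_card_erase (s := A) (a := y)
    omega
  · rw [Finset.card_pair]
    exact (hy _).symm
  · rw [Finset.disjoint_left]
    intro a ha ha'
    have ha2 := Finset.mem_erase.1 ha
    simp only [Finset.mem_insert, Finset.mem_singleton] at ha'
    rcases ha' with h | h
    · exact ha2.1 h
    · exact hAQ a ha2.2 _ h.symm
  · intro a ha
    have ha' := Finset.mem_erase.1 ha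
    exact ⟨hAd a ha'.2, fun i _ => hAQ a ha'.2 i⟩
  · intro a ha
    rw [show 2 * p + 1 - 1 = 2 * p by omega]
    simp only [Finset.mem_insert, Finset.mem_singleton] at ha
    rcases ha with rfl | rfl
    · exact ⟨hyd, fun i _ => hy i⟩
    · refine ⟨hadj _, fun i hi h => ?_⟩
      have := hinj _ _ (by omega) le_rfl h
      omega
  · intro i hi k hk h
    exact hinj i k (by omega) (by omega) h
  · intro i _
    exact hadj i

lemma blue_final {V : Type*} [DecidableEq V] (p n : ℕ) (hp : 4 ≤ p) (H : SimpleGraph V)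
    (Q : ℕ → V) (u : V) (hQu : ∀ i, Q i ≠ u)
    (hinj : ∀ i k, 1 ≤ i → i ≤ 2 * p + 2 → 1 ≤ k → k ≤ 2 * p + 2 → Q i = Q k → i = k)
    (hQ : ∀ i, H.Adj (Q i) (Q (i + 1)))
    (A : Finset V) (hA : n + 1 ≤ A.card) (hAQ : ∀ a ∈ A, ∀ i, Q i ≠ a)
    (hAd : ∀ a ∈ A, H.Adj (Q (2 * p + 2)) a)
    (hu2 : ¬ H.Adj u (Q 2)) (hup : ¬ H.Adj u (Q (2 * p)))
    (h2 : ∀ i, 1 ≤ i → i ≤ 2 * p + 2 → i ≠ 2 → i ≠ 2 * p → H.Adj (Q 2) (Q i))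
    (h2p : ∀ i, 1 ≤ i → i ≤ 2 * p + 2 → i ≠ 2 → i ≠ 2 * p → H.Adj (Q (2 * p)) (Q i))
    (S : Finset ℕ) (hS : p + 1 ≤ S.card)
    (hSm : ∀ i ∈ S, 1 ≤ i ∧ i ≤ 2 * p + 2 ∧ H.Adj u (Q i)) :
    HasCopy (LinkedDoubleStar (2 * p + 1) n 2) H := by
  by_contra hcon
  -- distance two
  have hd2 : ∀ i, 3 ≤ i → i + 2 ≤ 2 * p - 1 → H.Adj u (Q i) → H.Adj u (Q (i + 2)) → False := by
    intro i hi hi2 ha hb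
    apply hcon
    refine blue_end p n H Q u hQu hinj A hA hAQ hAd (fun k => 2 * p + 2 - k)
      (fun k => if k = 2 * p + 1 - i then u else Q (2 * p + 2 - k)) ?_ ?_ (2 * p + 1 - i)
      (fun _ => rfl) ?_ ?_ ?_ (i + 1) (by omega) (by omega) ?_
      (hQ 1).symm (h2 _ (by omega) (by omega) (by omega) (by omega))
    · grind
    · grind
    · intro k hk
      split_ifs with h3 h4 h4
      · omega
      · rw [show 2 * p + 2 - (k + 1) = i by omega]; exact ha
      · rw [show 2 * p + 2 - k = i + 2 by omega]; exact hb.symm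
      · have := hQ (2 * p + 2 - (k + 1))
        rw [show 2 * p + 2 - (k + 1) + 1 = 2 * p + 2 - k by omega] at this
        exact this.symm
    · grind
    · grind
    · grind
  have hd1 : ∀ i, 3 ≤ i → i + 1 ≤ 2 * p - 1 → H.Adj u (Q i) → H.Adj u (Q (i + 1)) → False := by
    intro i hi hi2 ha hb
    apply hcon
    -- positions: 0 ↦ 2p+2; k ≥ 1 ↦ 2p+1-k down to i+1 at k = 2p - i; u at 2p+1-i; then 2p+2-k
    refine blue_end p n H Q u hQu hinj A hA hAQ hAd
      (fun k => if k = 0 then 2 * p + 2 else if k < 2 * p + 1 - i then 2 * p + 1 - k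
        else 2 * p + 2 - k)
      (fun k => if k = 2 * p + 1 - i then u else
        Q (if k = 0 then 2 * p + 2 else if k < 2 * p + 1 - i then 2 * p + 1 - k
        else 2 * p + 2 - k)) ?_ ?_ (2 * p + 1 - i)
      (fun _ => rfl) ?_ ?_ ?_ (2 * p + 1) (by omega) (by omega) ?_
      (hQ 1).symm (h2 _ (by omega) (by omega) (by omega) (by omega))
    · grind
    · grind
    · intro k hk
      by_cases k0 : k = 0
      · subst k0
        rw [if_neg (by omega), if_pos rfl, if_neg (by omega), if_neg (by omega), if_pos (by omega)]
        exact (h2p _ (by omega) (by omega) (by omega) (by omega)).symm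
      rw [if_neg k0, if_neg (by omega : ¬ k + 1 = 0)]
      split_ifs with h3 h4 h5 h6 h7 h8 h9 <;> try omega
      · rw [show 2 * p + 2 - (k + 1) = i by omega]; exact ha
      · rw [show 2 * p + 1 - k = i + 1 by omega]; exact hb.symm
      · have := hQ (2 * p + 1 - (k + 1))
        rw [show 2 * p + 1 - (k + 1) + 1 = 2 * p + 1 - k by omega] at this
        exact this.symm
      · have := hQ (2 * p + 2 - (k + 1))
        rw [show 2 * p + 2 - (k + 1) + 1 = 2 * p + 2 - k by omega] at this
        exact this.symm
    · grind
    · grind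
    · grind
  have hd0 : H.Adj u (Q (2 * p + 1)) → H.Adj u (Q (2 * p + 2)) → False := by
    intro ha hb
    apply hcon
    refine blue_end p n H Q u hQu hinj A hA hAQ hAd
      (fun k => if k = 0 then 2 * p + 2 else if k < 4 then 2 * p + 3 - k
        else 2 * p + 2 - k)
      (fun k => if k = 1 then u else
        Q (if k = 0 then 2 * p + 2 else if k < 4 then 2 * p + 3 - k
        else 2 * p + 2 - k)) ?_ ?_ 1
      (fun _ => rfl) ?_ ?_ ?_ (2 * p - 1) (by omega) (by omega) ?_
      (hQ 1).symm (h2 _ (by omega) (by omega) (by omega) (by omega))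
    · grind
    · grind
    · intro k hk
      rcases k with _ | _ | _ | _ | k
      · simpa using hb.symm
      · simpa using ha
      · have := (hQ (2 * p)).symm
        simpa using this
      · have := h2p (2 * p - 2) (by omega) (by omega) (by omega) (by omega)
        simpa using this
      · have := hQ (2 * p + 2 - (k + 5))
        rw [show 2 * p + 2 - (k + 5) + 1 = 2 * p + 2 - (k + 4) by omega] at this
        rw [if_neg (by omega), if_neg (by omega), if_neg (by omega), if_neg (by omega),
          if_neg (by omega), if_neg (by omega)]
        exact this.symm
    · grind
    · grind
    · grind
  -- counting
  have hcard : S.card ≤ (Finset.range p).card := by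
    apply Finset.card_le_card_of_injOn
      (fun i => if i = 1 then 1 else if 2 * p + 1 ≤ i then 0 else if i ≤ 5 then 2 else i / 2)
    · intro i hi
      have h := hSm i hi
      have : i ≠ 2 * p := by rintro rfl; exact hup h.2.2
      simp only [Finset.coe_range, Set.mem_Iio]
      split_ifs <;> omega
    · have key : ∀ i ∈ S, ∀ k ∈ S, i < k →
          (if i = 1 then 1 else if 2 * p + 1 ≤ i then 0 else if i ≤ 5 then 2 else i / 2) ≠
          (if k = 1 then 1 else if 2 * p + 1 ≤ k then 0 else if k ≤ 5 then 2 else k / 2) := by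
        intro i hi k hk hik h
        obtain ⟨hi1, hi2, hi⟩ := hSm i hi
        obtain ⟨hk1, hk2, hk⟩ := hSm k hk
        have hn1 : i ≠ 2 := by rintro rfl; exact hu2 hi
        have hn2 : k ≠ 2 := by rintro rfl; exact hu2 hk
        have hn3 : i ≠ 2 * p := by rintro rfl; exact hup hi
        have hn4 : k ≠ 2 * p := by rintro rfl; exact hup hk
        have hc : (i = 2 * p + 1 ∧ k = 2 * p + 2) ∨ (3 ≤ i ∧ k ≤ 2 * p - 1 ∧ k = i + 1) ∨
            (3 ≤ i ∧ k ≤ 2 * p - 1 ∧ k = i + 2) := by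
          split_ifs at h <;> omega
        rcases hc with ⟨rfl, rfl⟩ | ⟨h3, h4, rfl⟩ | ⟨h3, h4, rfl⟩
        · exact hd0 hi hk
        · exact hd1 i h3 h4 hi hk
        · exact hd2 i h3 h4 hi hk
      intro i hi k hk h
      rcases lt_trichotomy i k with h' | h' | h'
      · exact absurd h (key i hi k hk h')
      · exact h'
      · exact absurd h.symm (key k hk i hi h')
  rw [Finset.card_range] at hcard
  omega

theorem lds_min_degree_one (p n : ℕ) (hp : 4 ≤ p) (hn2 : 2 ≤ n) (hnp : n ≤ p - 2)
    {V : Type*} [Fintype V] (hV : Fintype.card V = n + 3 * p + 3)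
    (G : SimpleGraph V) (q : ZMod (2 * p + 2) → V) (hq : IsCycleMap Gᶜ q)
    (u : V) (hu : u ∉ Set.range q)
    (hprimed : ∀ z ∉ Set.range q,
      ({w ∈ Set.range q | Gᶜ.Adj z w}).ncard ≤ ({w ∈ Set.range q | Gᶜ.Adj u w}).ncard)
    (hS : p + 1 ≤ ({w ∈ Set.range q | Gᶜ.Adj u w}).ncard)
    (hT : p + 2 ≤
      ({w ∈ Set.range q | p + 1 ≤ ({z | z ∉ Set.range q ∧ G.Adj w z}).ncard}).ncard)
    (hblue : ∃ w ∈ Set.range q, n + 1 ≤ ({z | z ∉ Set.range q ∧ Gᶜ.Adj w z}).ncard) :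
    HasMonoLDS G (2 * p + 1) n 2 := by
  classical
  by_contra hcon
  obtain ⟨hred, hbl⟩ := not_or.1 hcon
  obtain ⟨_, ⟨s, rfl⟩, hs⟩ := hblue
  let Z : Finset V := Finset.univ.filter (fun v => v ∉ Set.range q)
  have hZm : ∀ v, v ∈ Z ↔ v ∉ Set.range q := fun v => by simp [Z]
  have hZc : Z.card = n + p + 1 := by
    have h1 : Zᶜ = Finset.univ.image q := by
      ext v; simp [Z]
    have h2 : (Finset.univ.image q).card = 2 * p + 2 := by
      rw [Finset.card_image_of_injective _ hq.1, Finset.card_univ, ZMod.card]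
    have h3 := Finset.card_add_card_compl Z
    rw [h1, h2, hV] at h3
    omega
  let A : Finset V := Z.filter (fun v => Gᶜ.Adj (q s) v)
  have hA : n + 1 ≤ A.card := by
    rw [← Set.ncard_coe_finset]
    convert hs using 2
    ext v; simp [A, Z]
  let Q : ℕ → V := fun i => q (s + (i : ZMod (2 * p + 2)))
  have hQr : ∀ i, Q i ∈ Set.range q := fun i => ⟨_, rfl⟩
  have hQ : ∀ i, Gᶜ.Adj (Q i) (Q (i + 1)) := by
    intro i
    have := hq.2 (s + i)
    simpa [Q, add_assoc] using this
  have hinj' : ∀ i k, Q i = Q k → i % (2 * p + 2) = k % (2 * p + 2) := by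
    intro i k h
    have := add_left_cancel (hq.1 h)
    exact (ZMod.natCast_eq_natCast_iff' _ _ _).1 this
  have hinj : ∀ i k, 1 ≤ i → i ≤ 2 * p + 2 → 1 ≤ k → k ≤ 2 * p + 2 → Q i = Q k → i = k := by
    intro i k h1 h2 h3 h4 h
    have h5 := hinj' i k h
    rcases h2.lt_or_eq with h2 | rfl <;> rcases h4.lt_or_eq with h4 | rfl
    · rwa [Nat.mod_eq_of_lt h2, Nat.mod_eq_of_lt h4] at h5
    · rw [Nat.mod_eq_of_lt h2, Nat.mod_self] at h5; omega
    · rw [Nat.mod_eq_of_lt h4, Nat.mod_self] at h5; omega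
    · rfl
  have hQ0 : Q 0 = q s := by simp [Q]
  have hQL : Q (2 * p + 2) = q s := by
    have : ((2 * p + 2 : ℕ) : ZMod (2 * p + 2)) = 0 := ZMod.natCast_self _
    simp only [Q, this, add_zero]
  have hsurj : ∀ v ∈ Set.range q, ∃ i, 1 ≤ i ∧ i ≤ 2 * p + 2 ∧ Q i = v := by
    rintro _ ⟨x, rfl⟩
    by_cases h : (x - s).val = 0
    · refine ⟨2 * p + 2, by omega, le_rfl, ?_⟩
      rw [hQL]
      rw [ZMod.val_eq_zero, sub_eq_zero] at h
      rw [h]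
    · refine ⟨(x - s).val, by omega, (ZMod.val_lt _).le, ?_⟩
      simp [Q]
  have hZQ : ∀ v ∈ Z, ∀ i, Q i ≠ v := by
    intro v hv i h
    exact (hZm v).1 hv (h ▸ hQr i)
  have hAZ : ∀ v ∈ A, ∀ i, Q i ≠ v := fun v hv => hZQ v (Finset.mem_filter.1 hv).1
  have hAd : ∀ v ∈ A, Gᶜ.Adj (q s) v := fun v hv => (Finset.mem_filter.1 hv).2
  have hqZ : ∀ i, Q i ∉ Z := fun i h => hZQ _ h i rfl
  -- `Q (2p)` and `Q 2` are red to all of `Z`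
  have toRed : ∀ a b, a ≠ b → ¬ Gᶜ.Adj a b → G.Adj a b := by
    intro a b hab h
    by_contra h'
    exact h ((SimpleGraph.compl_adj _ _ _).2 ⟨hab, h'⟩)
  have hf2p : ∀ y ∈ Z, G.Adj (Q (2 * p)) y := by
    intro y hy
    apply toRed _ _ (hZQ y hy _)
    intro h
    apply hbl
    refine blue_simple p n Gᶜ Q ?_ hQ A hA hAZ ?_ y (hZQ y hy) h
    · intro i k hi hk h
      have := hinj' i k h
      rwa [Nat.mod_eq_of_lt (by omega), Nat.mod_eq_of_lt (by omega)] at this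
    · rw [hQ0]; exact hAd
  have hf2 : ∀ y ∈ Z, G.Adj (Q 2) y := by
    intro y hy
    apply toRed _ _ (hZQ y hy _)
    intro h
    apply hbl
    have hneg : ∀ i, i ≤ 2 * p + 2 → q (s - (i : ZMod (2 * p + 2))) = Q (2 * p + 2 - i) := by
      intro i hi
      simp only [Q]
      rw [Nat.cast_sub hi, ZMod.natCast_self]
      congr 1; ring
    refine blue_simple p n Gᶜ (fun i => q (s - (i : ZMod (2 * p + 2)))) ?_ ?_ A hA ?_ ?_ y ?_ ?_
    · intro i k hi hk h
      rw [hneg _ (by omega), hneg _ (by omega)] at h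
      have := hinj _ _ (by omega) (by omega) (by omega) (by omega) h
      omega
    · intro i
      have := hq.2 (s - ((i + 1 : ℕ) : ZMod (2 * p + 2)))
      have e : s - ((i + 1 : ℕ) : ZMod (2 * p + 2)) + 1 = s - (i : ZMod (2 * p + 2)) := by
        push_cast; ring
      rw [e] at this
      exact this.symm
    · intro a ha i h
      exact (hZm a).1 (Finset.mem_filter.1 ha).1 ⟨_, h⟩
    · simpa using hAd
    · intro i h
      exact (hZm y).1 hy ⟨_, h⟩
    · rw [hneg _ (by omega), show 2 * p + 2 - 2 * p = 2 by omega]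
      exact h
  -- red
  let T : Finset V := (Finset.univ.image q).filter
    (fun w => p + 1 ≤ (Z.filter (fun v => G.Adj w v)).card)
  have hTc : p + 2 ≤ T.card := by
    rw [← Set.ncard_coe_finset]
    convert hT using 2
    ext w
    have : ({z | z ∉ Set.range q ∧ G.Adj w z}).ncard = (Z.filter (fun v => G.Adj w v)).card := by
      rw [← Set.ncard_coe_finset]
      congr 1
      ext v; simp [Z]
    simp only [Set.mem_ofPred_eq, this]
    simp [T]
  have hTZ : Disjoint T Z := by
    rw [Finset.disjoint_left]
    intro v hv hv'
    simp only [T, Finset.mem_filter, Finset.mem_image, Finset.mem_univ, true_and] at hv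
    exact (hZm v).1 hv' hv.1
  have hTd : ∀ a ∈ T, ∃ S ⊆ Z, p + 1 ≤ S.card ∧ ∀ b ∈ S, G.Adj a b := by
    intro a ha
    exact ⟨_, Finset.filter_subset _ _, (Finset.mem_filter.1 ha).2,
      fun b hb => (Finset.mem_filter.1 hb).2⟩
  have hne : ∀ i k, 1 ≤ i → i ≤ 2 * p + 2 → 1 ≤ k → k ≤ 2 * p + 2 → i ≠ k → Q i ≠ Q k :=
    fun i k h1 h2 h3 h4 h h' => h (hinj i k h1 h2 h3 h4 h')
  have hb2 : ∀ i, 1 ≤ i → i ≤ 2 * p + 2 → i ≠ 2 → i ≠ 2 * p → Gᶜ.Adj (Q 2) (Q i) := by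
    intro i h1 h2 h3 h4
    by_contra h
    have h5 := toRed _ _ (hne 2 i (by omega) (by omega) h1 h2 h3.symm) h
    exact hred (red_case p n hp hnp G Z T hZc hTc hTZ hTd (Q 2) (Q (2 * p)) (Q i) (hqZ _) (hqZ _)
      (hqZ _) (hne _ _ (by omega) (by omega) (by omega) (by omega) (by omega))
      (hne _ _ h1 h2 (by omega) (by omega) h3) (hne _ _ h1 h2 (by omega) (by omega) h4)
      hf2 hf2p h5)
  have hb2p : ∀ i, 1 ≤ i → i ≤ 2 * p + 2 → i ≠ 2 → i ≠ 2 * p → Gᶜ.Adj (Q (2 * p)) (Q i) := by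
    intro i h1 h2 h3 h4
    by_contra h
    have h5 := toRed _ _ (hne (2 * p) i (by omega) (by omega) h1 h2 h4.symm) h
    exact hred (red_case p n hp hnp G Z T hZc hTc hTZ hTd (Q (2 * p)) (Q 2) (Q i) (hqZ _) (hqZ _)
      (hqZ _) (hne _ _ (by omega) (by omega) (by omega) (by omega) (by omega))
      (hne _ _ h1 h2 (by omega) (by omega) h4) (hne _ _ h1 h2 (by omega) (by omega) h3)
      hf2p hf2 h5)
  have huZ : u ∈ Z := (hZm u).2 hu
  let S : Finset ℕ := (Finset.Icc 1 (2 * p + 2)).filter (fun i => Gᶜ.Adj u (Q i))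
  have hSc : p + 1 ≤ S.card := by
    refine hS.trans ?_
    have : {w ∈ Set.range q | Gᶜ.Adj u w} ⊆ ((S.image Q : Finset V) : Set V) := by
      rintro w ⟨hw, hw2⟩
      obtain ⟨i, h1, h2, rfl⟩ := hsurj w hw
      simp only [Finset.coe_image]
      exact ⟨i, by simpa [S] using ⟨⟨h1, h2⟩, hw2⟩, rfl⟩
    refine (Set.ncard_le_ncard this (Finset.finite_toSet _)).trans ?_
    rw [Set.ncard_coe_finset]
    exact Finset.card_image_le
  refine hbl (blue_final p n hp Gᶜ Q u (hZQ u huZ) hinj hQ A hA hAZ ?_ ?_ ?_ hb2 hb2p S hSc ?_)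
  · rw [hQL]; exact hAd
  · intro h
    exact ((SimpleGraph.compl_adj _ _ _).1 h).2 (hf2 u huZ).symm
  · intro h
    exact ((SimpleGraph.compl_adj _ _ _).1 h).2 (hf2p u huZ).symm
  · intro i hi
    simp only [S, Finset.mem_filter, Finset.mem_Icc] at hi
    exact ⟨hi.1.1, hi.1.2, hi.2⟩
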